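/- Let G be a finite simple graph on vertex set {x_1,…,x_n} without isolated vertices. Then G is perfect if and only if for every b ∈ ℕ and every nonzero a = (a_1,…,a_n) ∈ ℕ^n, a is an irreducible b-cover of the blocker Υ(G) if and only if a_i ∈ {0,1} for all i and the set {x_i : a_i > 0} induces a complete subgraph of G with b + 1 vertices. -/

import Mathlib

/-- `C` is a vertex cover of `G`: every edge has an endpoint in `C`. -/
def IsVC {n : ℕ} (G : SimpleGraph (Fin n)) (C : Finset (Fin n)) : Prop :=
  ∀ i j : Fin n, G.Adj i j → i ∈ C ∨ j ∈ C

/-- `C` is a minimal vertex cover of `G`. -/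
def IsMinVC {n : ℕ} (G : SimpleGraph (Fin n)) (C : Finset (Fin n)) : Prop :=
  IsVC G C ∧ ∀ D : Finset (Fin n), D ⊂ C → ¬ IsVC G D

/-- A nonzero vector `a : ℕ^n` is a `b`-cover of the blocker `Υ(G)` (the clutter of
minimal vertex covers of `G`) if `∑_{i ∈ C} a i ≥ b` for every minimal vertex
cover `C` of `G`. -/
def IsUpsCover {n : ℕ} (G : SimpleGraph (Fin n)) (a : Fin n → ℕ) (b : ℕ) : Prop :=
  a ≠ 0 ∧ ∀ C : Finset (Fin n), IsMinVC G C → b ≤ ∑ i ∈ C, a i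

/-- A `b`-cover of the blocker `Υ(G)` is irreducible if it is not the sum of a
(nonzero) `i`-cover and a (nonzero) `j`-cover of `Υ(G)` with `b = i + j`. -/
def IsIrredUpsCover {n : ℕ} (G : SimpleGraph (Fin n)) (a : Fin n → ℕ) (b : ℕ) : Prop :=
  IsUpsCover G a b ∧
    ¬ ∃ (c d : Fin n → ℕ) (i j : ℕ),
        IsUpsCover G c i ∧ IsUpsCover G d j ∧ a = c + d ∧ b = i + j

/-- The clique number of a graph: the largest size of a clique. -/
noncomputable def cliqueNum {V : Type} (G : SimpleGraph V) : ℕ :=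
  sSup {k : ℕ | ∃ t : Finset V, G.IsNClique k t}

/-- A graph is perfect if for every induced subgraph the chromatic number equals
the clique number. -/
def IsPerfect {V : Type} (G : SimpleGraph V) : Prop :=
  ∀ S : Set V, (G.induce S).chromaticNumber = (cliqueNum (G.induce S) : ℕ∞)

/-- indicator -/
def ind1 {V : Type} [DecidableEq V] (K : Finset V) (v : V) : ℕ := if v ∈ K then 1 else 0

/-- `w` is a sum of `k` clique indicators. -/
def Col {V : Type} [DecidableEq V] (H : SimpleGraph V) (k : ℕ) (w : V → ℕ) : Prop :=
  ∃ A : Fin k → Finset V, (∀ i, H.IsClique (A i : Set V)) ∧ ∀ v, w v = ∑ i, ind1 (A i) v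

/-- independent sets have weight at most `k`. -/
def WB {V : Type} (H : SimpleGraph V) (k : ℕ) (w : V → ℕ) : Prop :=
  ∀ I : Finset V, Hᶜ.IsClique (I : Set V) → ∑ v ∈ I, w v ≤ k

def Full {V : Type} [DecidableEq V] (H : SimpleGraph V) : Prop :=
  ∀ k w, WB H k w → Col H k w

def Perf01 {V : Type} [DecidableEq V] (H : SimpleGraph V) : Prop :=
  ∀ k w, (∀ v, w v ≤ 1) → WB H k w → Col H k w

section
variable {V : Type} [DecidableEq V] {H : SimpleGraph V}

lemma ind1_le (K : Finset V) (v : V) : ind1 K v ≤ 1 := by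
  unfold ind1; split_ifs <;> simp

lemma ind1_mem {K : Finset V} {v : V} (h : v ∈ K) : ind1 K v = 1 := by simp [ind1, h]

lemma ind1_not {K : Finset V} {v : V} (h : v ∉ K) : ind1 K v = 0 := by simp [ind1, h]

lemma inter_le {K I : Finset V} (hK : H.IsClique (K : Set V)) (hI : Hᶜ.IsClique (I : Set V)) :
    ∑ v ∈ I, ind1 K v ≤ 1 := by
  unfold ind1
  rw [← Finset.sum_filter, ← Finset.card_eq_sum_ones, Finset.card_le_one]
  intro a ha b hb
  simp only [Finset.mem_filter] at ha hb
  by_contra hne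
  have h1 := hK (Finset.mem_coe.2 ha.2) (Finset.mem_coe.2 hb.2) hne
  have h2 := hI (Finset.mem_coe.2 ha.1) (Finset.mem_coe.2 hb.1) hne
  rw [SimpleGraph.compl_adj] at h2
  exact h2.2 h1

lemma Col.zero (k : ℕ) : Col H k (fun _ => 0) :=
  ⟨fun _ => ∅, by simp, by simp [ind1]⟩

lemma Col.add {k l : ℕ} {w u : V → ℕ} (h1 : Col H k w) (h2 : Col H l u) :
    Col H (k + l) (fun v => w v + u v) := by
  obtain ⟨A, hA, hw⟩ := h1
  obtain ⟨B, hB, hu⟩ := h2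
  refine ⟨Fin.append A B, ?_, ?_⟩
  · intro i
    refine Fin.addCases ?_ ?_ i
    · intro i; simpa using hA i
    · intro i; simpa using hB i
  · intro v
    rw [Fin.sum_univ_add]
    simp [hw, hu]

lemma Col.one {K : Finset V} (hK : H.IsClique (K : Set V)) : Col H 1 (ind1 K) :=
  ⟨fun _ => K, fun _ => hK, by simp⟩

lemma Col.mono {k l : ℕ} {w : V → ℕ} (h1 : Col H k w) (h : k ≤ l) : Col H l w := by
  have := h1.add (Col.zero (H := H) (l - k))
  rw [Nat.add_sub_cancel' h] at this
  simpa using this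

lemma Col.wb {k : ℕ} {w : V → ℕ} (h : Col H k w) : WB H k w := by
  obtain ⟨A, hA, hw⟩ := h
  intro I hI
  simp only [hw]
  rw [Finset.sum_comm]
  calc _ ≤ ∑ i : Fin k, 1 := Finset.sum_le_sum fun i _ => inter_le (hA i) hI
    _ = k := by simp

lemma replication [Fintype V] (hH : Perf01 H) : Full H := by
  suffices h : ∀ N, ∀ w : V → ℕ, ∑ v, w v ≤ N → ∀ k, WB H k w → Col H k w from
    fun k w => h _ w le_rfl k
  intro N
  induction N with
  | zero =>
    intro w hN k hw
    refine hH k w (fun v => ?_) hw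
    have := Finset.single_le_sum (f := w) (fun i _ => Nat.zero_le _) (Finset.mem_univ v)
    omega
  | succ N ih =>
    intro w hN k hw
    by_cases h1 : ∀ v, w v ≤ 1
    · exact hH k w h1 hw
    push Not at h1
    obtain ⟨v, hv⟩ := h1
    have key : ∀ K : Finset V, v ∈ K → ∑ x, (w x - ind1 K x) ≤ N := by
      intro K hK
      have : ∑ x, (w x - ind1 K x) < ∑ x, w x :=
        Finset.sum_lt_sum (fun i _ => Nat.sub_le _ _)
          ⟨v, Finset.mem_univ _, by rw [ind1_mem hK]; omega⟩
      omega
    have hcol := ih (fun x => w x - ind1 {v} x) (key _ (by simp)) k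
      (fun I hI => (Finset.sum_le_sum fun i _ => Nat.sub_le _ _).trans (hw I hI))
    obtain ⟨A, hA, hwA⟩ := hcol
    beta_reduce at hwA
    have hex : ∃ i, v ∈ A i := by
      by_contra hno
      push Not at hno
      have := hwA v
      rw [Finset.sum_eq_zero (fun i _ => ind1_not (hno i)), ind1_mem (by simp)] at this
      omega
    obtain ⟨i, hi⟩ := hex
    have hge : ∀ x, ind1 (A i) x ≤ w x := by
      intro x
      have h2 := Finset.single_le_sum (f := fun i => ind1 (A i) x) (fun i _ => Nat.zero_le _)
        (Finset.mem_univ i)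
      have := hwA x
      beta_reduce at h2
      omega
    obtain ⟨m, rfl⟩ : ∃ m, k = m + 1 := ⟨k - 1, by have := i.2; omega⟩
    have hsub : ∀ I : Finset V, ∑ x ∈ I, (w x - ind1 (A i) x) + ∑ x ∈ I, ind1 (A i) x
        = ∑ x ∈ I, w x := by
      intro I
      rw [← Finset.sum_add_distrib]
      exact Finset.sum_congr rfl fun x _ => Nat.sub_add_cancel (hge x)
    have hcol2 := ih (fun x => w x - ind1 (A i) x) (key _ hi) m (by
      intro I hI
      have h3 := hsub I
      beta_reduce
      by_cases hvI : v ∈ I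
      · have h4 := hw I hI
        have h5 := Finset.single_le_sum (f := ind1 (A i)) (fun i _ => Nat.zero_le _) hvI
        rw [ind1_mem hi] at h5
        omega
      · have h4 : ∑ x ∈ I, w x = ∑ x ∈ I, ∑ j, ind1 (A j) x := by
          refine Finset.sum_congr rfl fun x hx => ?_
          rw [← hwA x, ind1_not, Nat.sub_zero]
          simp only [Finset.mem_singleton]
          rintro rfl
          exact hvI hx
        rw [Finset.sum_comm, Fin.sum_univ_succAbove _ i] at h4
        have h5 : ∑ j : Fin m, ∑ x ∈ I, ind1 (A (i.succAbove j)) x ≤ ∑ j : Fin m, 1 :=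
          Finset.sum_le_sum fun j _ => inter_le (hA _) hI
        simp at h5
        omega)
    have := hcol2.add (Col.one (hA i))
    convert this using 2 with x
    exact (Nat.sub_add_cancel (hge x)).symm

open Classical in
lemma dual [Fintype V] (hH : Full H) : Full Hᶜ := by
  intro k
  induction k with
  | zero =>
    intro w hw
    have : w = fun _ => 0 := by
      funext v
      have := hw {v} (by simp)
      simpa using this
    rw [this]; exact Col.zero _
  | succ k ih =>
    intro w hw
    by_cases hex : ∃ K : Finset V, Hᶜ.IsClique (K : Set V) ∧ (∀ v ∈ K, 0 < w v) ∧
        WB Hᶜ k (fun v => w v - ind1 K v)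
    · obtain ⟨K, hK, hs, hwb⟩ := hex
      have := (ih _ hwb).add (Col.one hK)
      convert this using 2 with x
      refine (Nat.sub_add_cancel ?_).symm
      by_cases hx : x ∈ K
      · rw [ind1_mem hx]; exact hs x hx
      · rw [ind1_not hx]; omega
    exfalso
    push Not at hex
    have hex2 : ∀ K : Finset V, ∃ I : Finset V, H.IsClique (I : Set V) ∧ 
        (Hᶜ.IsClique (K : Set V) → (∀ v ∈ K, 0 < w v) →
        k + 1 ≤ ∑ v ∈ I, (w v - ind1 K v)) := by
      intro K
      by_cases h1 : Hᶜ.IsClique (K : Set V) ∧ (∀ v ∈ K, 0 < w v)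
      · have := hex K h1.1 h1.2
        unfold WB at this
        push Not at this
        obtain ⟨I, hI, hlt⟩ := this
        rw [compl_compl] at hI
        exact ⟨I, hI, fun _ _ => hlt⟩
      · exact ⟨∅, by simp, fun a b => absurd ⟨a, b⟩ h1⟩
    choose I hI hIs using hex2
    have hw' : ∀ J : Finset V, H.IsClique (J : Set V) → ∑ v ∈ J, w v ≤ k + 1 := by
      intro J hJ
      exact hw J (by rwa [compl_compl])
    let T : Finset (Finset V) :=
      Finset.univ.filter fun K => Hᶜ.IsClique (K : Set V) ∧ (∀ v ∈ K, 0 < w v)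
    let S : Finset V := Finset.univ.filter fun v => 0 < w v
    have hT : ∅ ∈ T := by simp [T]
    have hN : 0 < T.card := Finset.card_pos.2 ⟨_, hT⟩
    let u : V → ℕ := fun v => ∑ K ∈ T, ind1 (I K ∩ S) v
    have hcl : ∀ K, H.IsClique ((I K ∩ S : Finset V) : Set V) := fun K =>
      (hI K).subset (by simp)
    have hwu : WB H (T.card - 1) u := by
      intro J hJ
      have hJT : J ∩ S ∈ T := by
        simp only [T, Finset.mem_filter, Finset.mem_univ, true_and]
        refine ⟨hJ.subset (by simp), fun v hv => ?_⟩
        simp [S] at hv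
        exact hv.2
      have hJT' := hJT
      simp only [T, Finset.mem_filter, Finset.mem_univ, true_and] at hJT'
      simp only [u]
      rw [Finset.sum_comm, ← Finset.add_sum_erase _ _ hJT]
      have h0 : ∑ x ∈ J, ind1 (I (J ∩ S) ∩ S) x = 0 := by
        refine Finset.sum_eq_zero fun x hx => ind1_not fun hx2 => ?_
        rw [Finset.mem_inter] at hx2
        have h1 := hIs _ hJT'.1 hJT'.2
        have h2 := hw' _ (hI (J ∩ S))
        have hxm : x ∈ J ∩ S := Finset.mem_inter.2 ⟨hx, hx2.2⟩
        have h3 : ∑ v ∈ I (J ∩ S), (w v - ind1 (J ∩ S) v) < ∑ v ∈ I (J ∩ S), w v :=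
          Finset.sum_lt_sum (fun i _ => Nat.sub_le _ _) ⟨x, hx2.1, by
            rw [ind1_mem hxm]
            have := hJT'.2 x hxm
            omega⟩
        omega
      rw [h0, zero_add, ← Finset.card_erase_of_mem hJT, Finset.card_eq_sum_ones]
      exact Finset.sum_le_sum fun K _ => inter_le (hcl K) hJ
    obtain ⟨B, hB, huB⟩ := hH _ _ hwu
    have hmul : ∀ K : Finset V, ∑ v, ind1 K v * w v = ∑ v ∈ K, w v := by
      intro K
      simp [ind1]
    have e1 : ∑ v, u v * w v = ∑ K ∈ T, ∑ v ∈ I K ∩ S, w v := by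
      simp only [u, Finset.sum_mul]
      rw [Finset.sum_comm]
      exact Finset.sum_congr rfl fun K _ => hmul _
    have e2 : ∑ v, u v * w v = ∑ i, ∑ v ∈ B i, w v := by
      simp only [huB, Finset.sum_mul]
      rw [Finset.sum_comm]
      exact Finset.sum_congr rfl fun K _ => hmul _
    have l1 : T.card * (k + 1) ≤ ∑ K ∈ T, ∑ v ∈ I K ∩ S, w v := by
      rw [← smul_eq_mul, ← Finset.sum_const]
      refine Finset.sum_le_sum fun K hK => ?_
      simp only [T, Finset.mem_filter, Finset.mem_univ, true_and] at hK
      have h1 := hIs K hK.1 hK.2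
      refine h1.trans ((Finset.sum_le_sum fun i _ => Nat.sub_le _ _).trans (le_of_eq ?_))
      symm
      refine Finset.sum_subset Finset.inter_subset_left fun x hx hx2 => ?_
      simp [S, hx] at hx2
      exact hx2
    have l2 : ∑ i, ∑ v ∈ B i, w v ≤ (T.card - 1) * (k + 1) := by
      calc _ ≤ ∑ i : Fin (T.card - 1), (k + 1) := Finset.sum_le_sum fun i _ => hw' _ (hB i)
        _ = _ := by simp
    have l3 : (T.card - 1) * (k + 1) < T.card * (k + 1) :=
      Nat.mul_lt_mul_of_pos_right (by omega) (by omega)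
    omega

open Classical in
lemma perfect_iff [Fintype V] (G : SimpleGraph V) : IsPerfect G ↔ Full Gᶜ := by
  constructor
  · intro hP
    refine replication ?_
    intro k w h1 hwb
    let S : Set V := {v | 0 < w v}
    have hle : cliqueNum (G.induce S) ≤ k := by
      refine csSup_le ⟨0, ∅, by simp⟩ ?_
      rintro m ⟨t, ht⟩
      have hc : Gᶜᶜ.IsClique ((t.map (Function.Embedding.subtype _) : Finset V) : Set V) := by
        rw [compl_compl]
        intro a ha b hb hab
        simp only [Finset.coe_map, Set.mem_image, Finset.mem_coe] at ha hb
        obtain ⟨a, ha, rfl⟩ := ha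
        obtain ⟨b, hb, rfl⟩ := hb
        exact ht.1 ha hb (fun h => hab (by rw [h]))
      have := hwb _ hc
      rw [Finset.sum_map] at this
      refine le_trans ?_ this
      rw [← ht.2, Finset.card_eq_sum_ones]
      exact Finset.sum_le_sum fun x _ => x.2
    have hcol : (G.induce S).Colorable k := by
      rw [← SimpleGraph.chromaticNumber_le_iff_colorable, hP S]
      exact_mod_cast hle
    obtain ⟨c⟩ := hcol
    refine ⟨fun i => Finset.univ.filter fun v => ∃ h : v ∈ S, c ⟨v, h⟩ = i, ?_, ?_⟩
    · intro i a ha b hb hab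
      simp only [Finset.coe_filter, Finset.mem_univ, true_and, Set.mem_ofPred_eq] at ha hb
      obtain ⟨ha, ha2⟩ := ha
      obtain ⟨hb, hb2⟩ := hb
      rw [SimpleGraph.compl_adj]
      refine ⟨hab, fun hadj => ?_⟩
      have : (G.induce S).Adj ⟨a, ha⟩ ⟨b, hb⟩ := hadj
      exact c.valid this (ha2.trans hb2.symm)
    · intro v
      by_cases hv : v ∈ S
      · have : w v = 1 := le_antisymm (h1 v) hv
        rw [this]
        simp [ind1, hv]
      · have h0 : w v = 0 := by simpa [S] using hv
        rw [h0]
        simp [ind1, hv]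
  · intro hF S
    apply le_antisymm
    · rw [SimpleGraph.chromaticNumber_le_iff_colorable]
      obtain ⟨A, hA, hw⟩ := hF (cliqueNum (G.induce S)) (fun v => if v ∈ S then 1 else 0) (by
        intro I hI
        rw [compl_compl] at hI
        rw [← Finset.sum_filter, ← Finset.card_eq_sum_ones]
        refine le_csSup ⟨Fintype.card S, ?_⟩ ⟨I.subtype (· ∈ S), ?_, ?_⟩
        · rintro m ⟨t, ht⟩
          rw [← ht.2]
          exact Finset.card_le_univ t
        · intro a ha b hb hab
          simp only [Finset.mem_coe, Finset.mem_subtype] at ha hb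
          exact hI ha hb (fun h => hab (Subtype.ext h))
        · rw [Finset.card_subtype])
      have hex : ∀ v : S, ∃ i, (v : V) ∈ A i := by
        intro v
        by_contra hno
        push Not at hno
        have := hw v
        rw [Finset.sum_eq_zero (fun i _ => ind1_not (hno i))] at this
        simp at this
      choose c hc using hex
      refine ⟨SimpleGraph.Coloring.mk c ?_⟩
      intro a b hab heq
      have hab' : G.Adj a b := hab
      have := hA (c a) (hc a) (by rw [heq]; exact hc b) hab'.ne
      rw [SimpleGraph.compl_adj] at this
      exact this.2 hab'
    · have hm : cliqueNum (G.induce S) ∈ {k : ℕ | ∃ t : Finset S, (G.induce S).IsNClique k t} :=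
        Nat.sSup_mem ⟨0, ∅, by simp⟩ ⟨Fintype.card S, by
          rintro m ⟨t, ht⟩
          rw [← ht.2]
          exact Finset.card_le_univ t⟩
      obtain ⟨t, ht⟩ := hm
      rw [← ht.2]
      exact ht.1.card_le_chromaticNumber

end

section
variable {n : ℕ} {G : SimpleGraph (Fin n)}

lemma cover_iff {a : Fin n → ℕ} {b : ℕ} : IsUpsCover G a b ↔
    a ≠ 0 ∧ ∀ I : Finset (Fin n), Gᶜ.IsClique (I : Set (Fin n)) →
      b + ∑ i ∈ I, a i ≤ ∑ i, a i := by
  refine and_congr_right fun _ => ⟨fun h I hI => ?_, fun h C hC => ?_⟩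
  · have hvc : IsVC G Iᶜ := by
      intro i j hij
      by_contra hno
      push Not at hno
      simp only [Finset.mem_compl, not_not] at hno
      have := hI hno.1 hno.2 hij.ne
      rw [SimpleGraph.compl_adj] at this
      exact this.2 hij
    obtain ⟨C, hCI, hC⟩ := exists_minimal_le_of_wellFoundedLT (IsVC G) _ hvc
    have h1 := h C ⟨hC.1, fun D hD hv => hD.2 (hC.2 hv hD.1)⟩
    have h2 : ∑ i ∈ C, a i ≤ ∑ i ∈ Iᶜ, a i := Finset.sum_le_sum_of_subset hCI
    have h3 := Finset.sum_compl_add_sum I a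
    omega
  · have h1 := h Cᶜ (by
      intro i hi j hj hij
      simp only [Finset.coe_compl, Set.mem_compl_iff, Finset.mem_coe] at hi hj
      rw [SimpleGraph.compl_adj]
      refine ⟨hij, fun hadj => ?_⟩
      rcases hC.1 i j hadj with h | h
      · exact hi h
      · exact hj h)
    have h3 := Finset.sum_compl_add_sum C a
    omega

lemma Col.cover {a : Fin n → ℕ} {k : ℕ} (h : Col G k a) (h0 : a ≠ 0) {b : ℕ}
    (hb : b + k ≤ ∑ i, a i ∨ b = 0) : IsUpsCover G a b := by
  rw [cover_iff]
  refine ⟨h0, fun I hI => ?_⟩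
  have h1 := h.wb I hI
  have h2 : ∑ i ∈ I, a i ≤ ∑ i, a i := Finset.sum_le_sum_of_subset (Finset.subset_univ _)
  omega

lemma cover_lt {a : Fin n → ℕ} {b : ℕ} (h : IsUpsCover G a b) : b + 1 ≤ ∑ i, a i := by
  rw [cover_iff] at h
  obtain ⟨u, hu⟩ := Function.ne_iff.1 h.1
  have h1 := h.2 {u} (by simp)
  simp at h1 hu
  omega

lemma not_irred {a c d : Fin n → ℕ} {b i j : ℕ} (h : IsIrredUpsCover G a b)
    (hc : IsUpsCover G c i) (hd : IsUpsCover G d j) (ha : a = c + d) (hb : b ≤ i + j) : False :=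
  h.2 ⟨c, d, min i b, b - min i b, ⟨hc.1, fun C hC => (min_le_left _ _).trans (hc.2 C hC)⟩,
    ⟨hd.1, fun C hC => le_trans (by omega) (hd.2 C hC)⟩, ha, by omega⟩

lemma sum_ind1 (K : Finset (Fin n)) : ∑ v, ind1 K v = K.card := by simp [ind1]

lemma ind1_ne {K : Finset (Fin n)} (h : K.Nonempty) : ind1 K ≠ 0 := by
  obtain ⟨v, hv⟩ := h
  intro h0
  have := congrFun h0 v
  rw [ind1_mem hv] at this
  simp at this

lemma irred_ind {a : Fin n → ℕ} {b : ℕ} (hF : Full G) (h : IsIrredUpsCover G a b) :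
    ∃ K : Finset (Fin n), G.IsClique (K : Set (Fin n)) ∧ a = ind1 K ∧ K.card = b + 1 := by
  have hlt := cover_lt h.1
  have hcov := cover_iff.1 h.1
  obtain ⟨k, hk⟩ : ∃ k, b + (k + 1) = ∑ i, a i := ⟨∑ i, a i - b - 1, by omega⟩
  have hcol : Col G (k + 1) a := hF _ _ (fun I hI => by have := hcov.2 I hI; omega)
  obtain ⟨A, hA, hwA⟩ := hcol
  have hex : ∃ i, (A i).Nonempty := by
    by_contra hno
    push Not at hno
    apply hcov.1
    funext v
    rw [hwA v]
    simp [hno, ind1]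
  obtain ⟨i, hi⟩ := hex
  let d : Fin n → ℕ := fun v => ∑ j, ind1 (A (i.succAbove j)) v
  have had : a = ind1 (A i) + d := by
    funext v
    rw [hwA v, Fin.sum_univ_succAbove _ i]
    rfl
  have hsum : ∑ v, a v = (A i).card + ∑ v, d v := by
    rw [← sum_ind1, ← Finset.sum_add_distrib, had]
    rfl
  have hpos := hi.card_pos
  have hcd : Col G k d := ⟨fun j => A (i.succAbove j), fun j => hA _, fun v => rfl⟩
  have hc1 : IsUpsCover G (ind1 (A i)) ((A i).card - 1) :=
    (Col.one (hA i)).cover (ind1_ne hi) (by rw [sum_ind1]; omega)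
  by_cases hd0 : d = 0
  · have ha : a = ind1 (A i) := by rw [had, hd0, add_zero]
    have hds : ∑ v, d v = 0 := by simp [hd0]
    rcases Nat.eq_zero_or_pos k with rfl | hk0
    · exact ⟨A i, hA i, ha, by omega⟩
    exfalso
    obtain ⟨v, hv⟩ := hi
    have hcard := Finset.card_erase_of_mem hv
    have hne : ((A i).erase v).Nonempty := Finset.card_pos.1 (by omega)
    have c1 : IsUpsCover G (ind1 {v}) 0 :=
      (Col.one (by simp)).cover (ind1_ne (by simp)) (Or.inr rfl)
    have c2 : IsUpsCover G (ind1 ((A i).erase v)) b :=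
      (Col.one ((hA i).subset (by simp))).cover (ind1_ne hne) (by
        rw [sum_ind1]; omega)
    refine not_irred h c1 c2 ?_ (by omega)
    rw [ha]
    funext x
    by_cases hx : x = v
    · subst hx; simp [ind1, hv]
    · simp [ind1, hx]
  · exfalso
    have c2 : IsUpsCover G d (∑ v, d v - k) := hcd.cover hd0 (by omega)
    exact not_irred h hc1 c2 had (by omega)

lemma sum_supp {a : Fin n → ℕ} (h1 : ∀ i, a i ≤ 1) :
    a = ind1 (Finset.univ.filter (fun i : Fin n => 0 < a i)) := by
  funext v
  have := h1 v
  simp only [ind1, Finset.mem_filter, Finset.mem_univ, true_and]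
  split_ifs <;> omega

lemma cover_col (h : ∀ (b : ℕ) (a : Fin n → ℕ), IsIrredUpsCover G a b → Col G 1 a ∧
    ∑ i, a i = b + 1) : ∀ N b (a : Fin n → ℕ), ∑ i, a i ≤ N → IsUpsCover G a b →
      Col G (∑ i, a i - b) a := by
  intro N
  induction N with
  | zero =>
    intro b a hN hc
    have := cover_lt hc
    omega
  | succ N ih =>
    intro b a hN hc
    by_cases hir : IsIrredUpsCover G a b
    · obtain ⟨h1, h2⟩ := h b a hir
      rw [h2, Nat.add_sub_cancel_left]
      exact h1
    · have : ∃ (c d : Fin n → ℕ) (i j : ℕ),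
        IsUpsCover G c i ∧ IsUpsCover G d j ∧ a = c + d ∧ b = i + j := by
        by_contra hno
        exact hir ⟨hc, hno⟩
      obtain ⟨c, d, i, j, hci, hdj, rfl, rfl⟩ := this
      have l1 := cover_lt hci
      have l2 := cover_lt hdj
      have hs : ∑ v, (c + d) v = ∑ v, c v + ∑ v, d v := Finset.sum_add_distrib
      have := (ih i c (by omega) hci).add (ih j d (by omega) hdj)
      rw [hs]
      refine Col.mono this (by omega)

end

theorem perfect_iff_irreducible_covers_are_cliques {n : ℕ}
    (G : SimpleGraph (Fin n)) (hG : ∀ i : Fin n, ∃ j : Fin n, G.Adj i j) :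
    IsPerfect G ↔
      ∀ (b : ℕ) (a : Fin n → ℕ), a ≠ 0 →
        (IsIrredUpsCover G a b ↔
          ((∀ i : Fin n, a i ≤ 1) ∧
            (∀ i j : Fin n, 0 < a i → 0 < a j → i ≠ j → G.Adj i j) ∧
            (Finset.univ.filter (fun i : Fin n => 0 < a i)).card = b + 1)) := by
  have hclq : ∀ (b : ℕ) (a : Fin n → ℕ), ((∀ i : Fin n, a i ≤ 1) ∧
            (∀ i j : Fin n, 0 < a i → 0 < a j → i ≠ j → G.Adj i j) ∧
            (Finset.univ.filter (fun i : Fin n => 0 < a i)).card = b + 1) →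
            Col G 1 a ∧ ∑ i, a i = b + 1 := by
    rintro b a ⟨h1, h2, h3⟩
    constructor
    · rw [sum_supp h1]
      apply Col.one
      intro x hx y hy hxy
      simp at hx hy
      exact h2 x y hx hy hxy
    · rw [← h3, ← sum_ind1, ← sum_supp h1]
  rw [perfect_iff]
  constructor
  · intro hF b a ha
    have hF' : Full G := by simpa using dual hF
    constructor
    · intro h
      obtain ⟨K, hK, rfl, hb⟩ := irred_ind hF' h
      have hp : ∀ i, 0 < ind1 K i ↔ i ∈ K := by intro i; unfold ind1; split_ifs with hh <;> simp [hh]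
      refine ⟨ind1_le K, fun i j hi hj hij => ?_, ?_⟩
      · exact hK ((hp i).1 hi) ((hp j).1 hj) hij
      · rw [← hb]; congr 1; ext i; simp [hp]
    · intro h
      obtain ⟨h1, h2⟩ := hclq b a h
      refine ⟨h1.cover ha (Or.inl h2.ge), ?_⟩
      rintro ⟨c, d, i, j, hc, hd, rfl, rfl⟩
      have l1 := cover_lt hc
      have l2 := cover_lt hd
      have hs : ∑ v, (c + d) v = ∑ v, c v + ∑ v, d v := Finset.sum_add_distrib
      omega
  · intro h
    apply dual
    have key := cover_col (G := G) fun b a hir => hclq b a ((h b a hir.1.1).1 hir)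
    intro k a hwb
    by_cases ha : a = 0
    · rw [ha]; exact Col.zero k
    have hc : IsUpsCover G a (∑ i, a i - k) := by
      rw [cover_iff]
      refine ⟨ha, fun I hI => ?_⟩
      have h1 := hwb I hI
      have h2 : ∑ i ∈ I, a i ≤ ∑ i, a i := Finset.sum_le_sum_of_subset (Finset.subset_univ _)
      omega
    exact (key _ _ a le_rfl hc).mono (by omega)
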